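/- arXiv:2108.01579 — 2 statements merged into one kernel-verified Lean document; each statement's English description precedes it below -/
import Mathlib

section
/- Let A ∈ ℝ^{n×n} be symmetric with zero diagonal, and suppose the undirected graph G on vertex set [1,n], with an edge {i,j} whenever [A]_{ij} ≠ 0, is a tree (connected and acyclic). Let B = e₁ and let d(j) denote the graph distance in G from vertex 1 to vertex j, with K the maximum of d(j) over all j. Suppose that for every k ∈ [0, K−1] all edges {i,j} with d(i) = k and d(j) = k+1 carry weights [A]_{ji} of the same sign (i.e., for each k there is σ_k ∈ {+1,−1} such that sign([A]_{ji}) = σ_k for every such edge). Then the pair (A, e₁) is herdable. -/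
/-- In a connected graph, a vertex at distance `k + 1` from `r` has a neighbor at distance `k`. -/
lemma SimpleGraph.Connected.exists_adj_dist_eq {V : Type*} {G : SimpleGraph V}
    (hconn : G.Connected) {r j : V} {k : ℕ} (h : G.dist r j = k + 1) :
    ∃ i, G.Adj i j ∧ G.dist r i = k := by
  obtain ⟨w, hw⟩ := hconn.exists_walk_length_eq_dist j r
  rw [G.dist_comm, h] at hw
  cases w with
  | nil => simp at hw
  | @cons _ i _ hadj p =>
    refine ⟨i, hadj.symm, le_antisymm ?_ ?_⟩
    · rw [G.dist_comm]
      have := G.dist_le p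
      simp only [SimpleGraph.Walk.length_cons] at hw
      omega
    · have := hconn.dist_triangle (u := r) (v := i) (w := j)
      rw [SimpleGraph.dist_eq_one_iff_adj.2 hadj.symm] at this
      omega

/-- Along a connected graph whose edges from level `k` to level `k + 1` have weights of sign `σ k`,
the vector `A ^ k e_r` vanishes beyond level `k`, and on level `k` has sign `∏ m < k, σ m`. -/
lemma pow_mulVec_single_of_level_sign {V : Type*} [Fintype V] [DecidableEq V]
    {A : Matrix V V ℝ} {G : SimpleGraph V}
    (hG : ∀ i j, G.Adj i j ↔ A i j ≠ 0) (hconn : G.Connected) (r : V) {σ : ℕ → ℝ}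
    (hsign : ∀ i j, G.Adj i j → G.dist r j = G.dist r i + 1 → 0 < σ (G.dist r i) * A j i)
    (k : ℕ) (j : V) :
    (k < G.dist r j → (A ^ k).mulVec (Pi.single r 1) j = 0) ∧
    (G.dist r j = k → 0 < (∏ m ∈ Finset.range k, σ m) * (A ^ k).mulVec (Pi.single r 1) j) := by
  induction k generalizing j with
  | zero =>
    constructor
    · intro h
      have hj : j ≠ r := by rintro rfl; simp at h
      simp [hj]
    · intro h
      obtain rfl := hconn.dist_eq_zero_iff.1 h
      simp
  | succ k ih =>
    have hstep : (A ^ (k + 1)).mulVec (Pi.single r 1) j =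
        ∑ i, A j i * (A ^ k).mulVec (Pi.single r 1) i := by
      rw [pow_succ', ← Matrix.mulVec_mulVec]
      rfl
    have hadj : ∀ i, A j i ≠ 0 → G.Adj i j := fun i hi => ((hG j i).2 hi).symm
    have hdist : ∀ i, G.Adj i j → G.dist r j ≤ G.dist r i + 1 := fun i hi => by
      simpa [SimpleGraph.dist_eq_one_iff_adj.2 hi] using
        hconn.dist_triangle (u := r) (v := i) (w := j)
    rw [hstep]
    constructor
    · intro h
      refine Finset.sum_eq_zero fun i _ => ?_
      by_cases hi : A j i = 0
      · simp [hi]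
      · have := hdist i (hadj i hi)
        rw [(ih i).1 (by omega), mul_zero]
    · intro h
      have hpos : ∀ i, G.Adj i j → G.dist r i = k → 0 < (∏ m ∈ Finset.range (k + 1), σ m) *
          (A j i * (A ^ k).mulVec (Pi.single r 1) i) := by
        intro i hi hik
        have h₁ := hsign i j hi (by omega)
        rw [hik] at h₁
        have h₂ := mul_pos h₁ ((ih i).2 hik)
        rw [Finset.prod_range_succ]
        calc 0 < _ := h₂
          _ = _ := by ring
      rw [Finset.mul_sum]
      refine Finset.sum_pos' (fun i _ => ?_) ?_
      · by_cases hi : A j i = 0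
        · simp [hi]
        · have := hdist i (hadj i hi)
          rcases (show k ≤ G.dist r i by omega).eq_or_lt with hk | hk
          · exact (hpos i (hadj i hi) hk.symm).le
          · simp [(ih i).1 hk]
      · obtain ⟨i, hi, hik⟩ := hconn.exists_adj_dist_eq h
        exact ⟨i, Finset.mem_univ i, hpos i hi hik⟩

/-- A real polynomial expression whose lowest-order coefficient is positive is positive at all
small positive arguments. -/
lemma eventually_sum_mul_pow_pos {n : ℕ} (a : Fin n → ℝ) (d : Fin n)
    (hlt : ∀ k < d, a k = 0) (hd : 0 < a d) :
    ∀ᶠ ε : ℝ in nhdsWithin 0 (Set.Ioi 0), 0 < ∑ k, a k * ε ^ (k : ℕ) := by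
  have hcont : Continuous fun ε : ℝ => ∑ k, a k * ε ^ ((k : ℕ) - (d : ℕ)) := by fun_prop
  have hzero : ∑ k, a k * (0 : ℝ) ^ ((k : ℕ) - (d : ℕ)) = a d := by
    rw [Finset.sum_eq_single d]
    · simp
    · intro k _ hk
      rcases hk.lt_or_gt with hk | hk
      · simp [hlt k hk]
      · rw [zero_pow (Nat.sub_ne_zero_of_lt hk), mul_zero]
    · simp
  have hev : ∀ᶠ ε : ℝ in nhds 0, 0 < ∑ k, a k * ε ^ ((k : ℕ) - (d : ℕ)) :=
    hcont.continuousAt.eventually (lt_mem_nhds (by simpa only [hzero] using hd))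
  filter_upwards [nhdsWithin_le_nhds hev, self_mem_nhdsWithin] with ε hε hε₀
  have hfac : ∑ k, a k * ε ^ (k : ℕ) =
      ε ^ (d : ℕ) * ∑ k, a k * ε ^ ((k : ℕ) - (d : ℕ)) := by
    rw [Finset.mul_sum]
    refine Finset.sum_congr rfl fun k _ => ?_
    rcases lt_or_ge k d with hk | hk
    · simp [hlt k hk]
    · rw [mul_left_comm, ← pow_add, Nat.add_sub_cancel' (Fin.le_def.1 hk)]
  rw [hfac]
  exact mul_pos (pow_pos hε₀ _) hε


open Matrix

/-- The controllability matrix `[B | AB | ... | A^{n-1}B]` for a single-input pair `(A, b)`. -/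
def ctrbMat {n : ℕ} (A : Matrix (Fin n) (Fin n) ℝ) (b : Fin n → ℝ) :
    Matrix (Fin n) (Fin n) ℝ :=
  Matrix.of fun i k => (A ^ (k : ℕ)).mulVec b i

theorem stmt11 {n : ℕ} (hn : 0 < n) (A : Matrix (Fin n) (Fin n) ℝ)
    -- A symmetric with zero diagonal
    (hsym : A.IsSymm) (hdiag : ∀ i, A i i = 0)
    -- G is the undirected graph with an edge {i,j} iff [A]_{ij} ≠ 0
    (G : SimpleGraph (Fin n)) (hG : ∀ i j, G.Adj i j ↔ A i j ≠ 0)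
    -- G is a tree
    (htree : G.IsTree)
    -- all edges from the vertices at distance k from vertex 1 to the vertices at
    -- distance k+1 from vertex 1 carry weights of the same sign σ_k ∈ {+1, -1}
    (σ : ℕ → ℝ) (hσ : ∀ k, σ k = 1 ∨ σ k = -1)
    (hsign : ∀ i j : Fin n, G.Adj i j →
      G.dist ⟨0, hn⟩ j = G.dist ⟨0, hn⟩ i + 1 →
      Real.sign (A j i) = σ (G.dist ⟨0, hn⟩ i)) :
    -- the pair (A, e₁) is herdable
    ∃ u : Fin n → ℝ, ∀ i, 0 < (ctrbMat A (Pi.single ⟨0, hn⟩ 1)).mulVec u i := by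
  have hconn := htree.1
  set r : Fin n := ⟨0, hn⟩
  have hsign' : ∀ i j, G.Adj i j → G.dist r j = G.dist r i + 1 →
      0 < σ (G.dist r i) * A j i := by
    intro i j hij hd
    rw [← hsign i j hij hd]
    exact Real.sign_mul_pos_of_ne_zero _ ((hG j i).1 hij.symm)
  have hlevel := pow_mulVec_single_of_level_sign hG hconn r hsign'
  have hlt : ∀ i, G.dist r i < n := by
    intro i
    obtain ⟨p, hp, hlen⟩ := hconn.exists_path_of_dist r i
    simpa [hlen] using hp.length_lt
  have hev : ∀ i, ∀ᶠ ε : ℝ in nhdsWithin 0 (Set.Ioi 0), 0 < ∑ k : Fin n,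
      ((∏ m ∈ Finset.range k, σ m) * (A ^ (k : ℕ)).mulVec (Pi.single r 1) i) * ε ^ (k : ℕ) :=
    fun i => eventually_sum_mul_pow_pos _ ⟨G.dist r i, hlt i⟩
      (fun k hk => by rw [(hlevel k i).1 hk, mul_zero]) ((hlevel _ i).2 rfl)
  obtain ⟨ε, hε⟩ := (Filter.eventually_all.2 hev).exists
  refine ⟨fun k => (∏ m ∈ Finset.range k, σ m) * ε ^ (k : ℕ), fun i => ?_⟩
  refine (hε i).trans_eq (Finset.sum_congr rfl fun k _ => ?_)
  simp only [ctrbMat, Matrix.of_apply]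
  ring
end

section
/- Let n ≥ 2 and let A ∈ ℝ^{n×n} be symmetric with [A]_{1i} = [A]_{i1} ≠ 0 for every i ∈ [2,n] and all other entries (including the diagonal) equal to zero (so the graph G(A) is a star with center 1, i.e., all followers have distance one from the leader). Then the pair (A, e₁) is herdable if and only if all the entries [A]_{i1}, i ∈ [2,n], have the same sign. -/
open Matrix

/-- If row `i` of `A` is supported in column `z`, then for `A` applied to `v` only `v z` matters. -/
theorem mulVec_apply_of_row_eq_zero {n : ℕ} {A : Matrix (Fin n) (Fin n) ℝ} {i z : Fin n}
    (hrow : ∀ j, j ≠ z → A i j = 0) (v : Fin n → ℝ) : (A *ᵥ v) i = A i z * v z := by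
  rw [mulVec, dotProduct]
  exact Finset.sum_eq_single z (fun j _ hj => by rw [hrow j hj, zero_mul]) (by simp)

/-- All vectors reachable from the center of a star have their coordinates at the leaves
proportional to the edge weights. -/
theorem exists_ctrbMat_mulVec_eq_mul {n : ℕ} {A : Matrix (Fin n) (Fin n) ℝ} {z : Fin n}
    (hzero : ∀ i j, i ≠ z → j ≠ z → A i j = 0) (u : Fin n → ℝ) :
    ∃ c : ℝ, ∀ i, i ≠ z → (ctrbMat A (Pi.single z 1) *ᵥ u) i = c * A i z := by
  have hpow : ∀ k : ℕ, ∃ c : ℝ, ∀ i, i ≠ z → (A ^ k *ᵥ Pi.single z 1) i = c * A i z := by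
    rintro (_ | k)
    · exact ⟨0, fun i hi => by simp [hi]⟩
    · refine ⟨(A ^ k *ᵥ Pi.single z 1) z, fun i hi => ?_⟩
      rw [pow_succ', ← mulVec_mulVec, mulVec_apply_of_row_eq_zero fun j => hzero i j hi, mul_comm]
  choose c hc using hpow
  refine ⟨∑ k : Fin n, c k * u k, fun i hi => ?_⟩
  rw [mulVec, dotProduct, Finset.sum_mul]
  refine Finset.sum_congr rfl fun k _ => ?_
  simp only [ctrbMat, of_apply, hc k i hi]
  ring

/-- The vector `b + s • A b` is reachable. -/
theorem exists_ctrbMat_mulVec_eq_add {n : ℕ} (hn : 2 ≤ n) (A : Matrix (Fin n) (Fin n) ℝ)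
    (b : Fin n → ℝ) (s : ℝ) : ∃ u, ctrbMat A b *ᵥ u = b + s • A *ᵥ b := by
  refine ⟨Pi.single ⟨0, by omega⟩ 1 + Pi.single ⟨1, by omega⟩ s, ?_⟩
  ext i
  simp [mulVec_add, ctrbMat]

theorem stmt13 {n : ℕ} (hn : 2 ≤ n) (A : Matrix (Fin n) (Fin n) ℝ)
    -- A symmetric
    (hsym : A.IsSymm)
    -- the entries on the first row/column (off the (1,1) position) are nonzero
    (hstar : ∀ i : Fin n, i ≠ ⟨0, by omega⟩ → A i ⟨0, by omega⟩ ≠ 0)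
    -- all other entries (including the diagonal) are zero
    (hzero : ∀ i j : Fin n, i ≠ ⟨0, by omega⟩ → j ≠ ⟨0, by omega⟩ → A i j = 0)
    (hdiag : A ⟨0, by omega⟩ ⟨0, by omega⟩ = 0) :
    -- (A, e₁) is herdable iff all the weights of the edges from the center have the same sign
    ((∃ u : Fin n → ℝ, ∀ i, 0 < (ctrbMat A (Pi.single ⟨0, by omega⟩ 1)).mulVec u i) ↔
      ((∀ i : Fin n, i ≠ ⟨0, by omega⟩ → 0 < A i ⟨0, by omega⟩) ∨
       (∀ i : Fin n, i ≠ ⟨0, by omega⟩ → A i ⟨0, by omega⟩ < 0))) := by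
  generalize_proofs h0 at *
  set z : Fin n := ⟨0, h0⟩
  constructor
  · rintro ⟨u, hu⟩
    obtain ⟨c, hc⟩ := exists_ctrbMat_mulVec_eq_mul hzero u
    have hpos : ∀ i, i ≠ z → 0 < c * A i z := fun i hi => hc i hi ▸ hu i
    rcases le_total 0 c with h | h
    · exact Or.inl fun i hi => pos_of_mul_pos_right (hpos i hi) h
    · exact Or.inr fun i hi => neg_of_mul_pos_right (hpos i hi) h
  · have key : ∀ s : ℝ, (∀ i, i ≠ z → 0 < s * A i z) →
        ∃ u : Fin n → ℝ, ∀ i, 0 < (ctrbMat A (Pi.single z 1) *ᵥ u) i := by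
      intro s hs
      obtain ⟨u, hu⟩ := exists_ctrbMat_mulVec_eq_add hn A (Pi.single z 1) s
      refine ⟨u, fun i => ?_⟩
      rw [hu]
      by_cases hi : i = z
      · subst hi
        simp [hdiag]
      · simpa [hi] using hs i hi
    rintro (h | h)
    · exact key 1 fun i hi => by simpa using h i hi
    · exact key (-1) fun i hi => by simpa using h i hi
end
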